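/- arXiv:2310.14144 — 4 statements merged into one kernel-verified Lean document; each statement's English description precedes it below -/
import Mathlib

section
/- For any trading path (J_0, q, J_T), the sum of the impact cost (1/2)(y + Y_0)J_0 + ∫₀ᵀ Y_t q_t dt + (1/2)(Y_{T−} + Y_T)J_T and the spread cost (1/2)∫₀ᵀ ε_t q_t² dt equals (1/2)[ ∫₀ᵀ ((2β_t + γ̇_t)/λ_t) Y_t² dt + ∫₀ᵀ ε_t q_t² dt + (Y_{T−} + λ_T J_T)²/λ_T + (1/λ_{0−} − 1/λ_0) Y_0² − y²/λ_{0−} ]. -/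
open Set MeasureTheory intervalIntegral

/-- If `Y` solves a linear Volterra equation with bounded coefficient `b` and integrable forcing
`r`, then the integrand is automatically integrable, so that the integral is never a junk value. -/
theorem intervalIntegrable_of_linear_volterra {T M y₀ : ℝ} {b r Y : ℝ → ℝ} (hT : 0 ≤ T)
    (hb_meas : Measurable b) (hb : ∀ t ∈ Icc (0 : ℝ) T, |b t| ≤ M)
    (hr : IntervalIntegrable r volume 0 T)
    (hY : ∀ t ∈ Icc (0 : ℝ) T, Y t = y₀ + ∫ s in (0 : ℝ)..t, (b s * Y s + r s)) :
    IntervalIntegrable (fun s => b s * Y s + r s) volume 0 T := by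
  set g : ℝ → ℝ := fun s => b s * Y s + r s with hg
  have hM : 0 ≤ M := (abs_nonneg _).trans (hb 0 ⟨le_rfl, hT⟩)
  let S : Set ℝ := {t | t ∈ Icc (0 : ℝ) T ∧ IntervalIntegrable g volume 0 t}
  have h0S : (0 : ℝ) ∈ S := ⟨⟨le_rfl, hT⟩, IntervalIntegrable.refl⟩
  have hSbdd : BddAbove S := ⟨T, fun t ht => ht.1.2⟩
  have hS_mono : ∀ {s t : ℝ}, t ∈ S → 0 ≤ s → s ≤ t → s ∈ S := fun {s t} ht hs hst =>
    ⟨⟨hs, hst.trans ht.1.2⟩, ht.2.mono_set (by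
      rw [uIcc_of_le hs, uIcc_of_le ht.1.1]; exact Icc_subset_Icc le_rfl hst)⟩
  set c := sSup S with hc
  have hc0 : 0 ≤ c := le_csSup hSbdd h0S
  have hcT : c ≤ T := csSup_le ⟨0, h0S⟩ fun t ht => ht.1.2
  have hS_of_lt : ∀ {t : ℝ}, 0 ≤ t → t < c → t ∈ S := fun {t} ht htc => by
    obtain ⟨u, hu, htu⟩ := exists_lt_of_lt_csSup ⟨0, h0S⟩ htc
    exact hS_mono hu ht htu.le
  have hcont : ∀ {t : ℝ}, t ∈ S → ContinuousOn Y (Icc 0 t) := fun {t} ht => by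
    have h := continuousOn_primitive_interval' ht.2 left_mem_uIcc
    rw [uIcc_of_le ht.1.1] at h
    exact (continuousOn_const.add h).congr fun s hs => hY s ⟨hs.1, hs.2.trans ht.1.2⟩
  obtain ⟨K, hK⟩ : ∃ K, ∀ t ∈ Ioo 0 c, |Y t| ≤ K := by
    have hδ : c - 1 / (2 * (M + 1)) < c := sub_lt_self _ (by positivity)
    obtain ⟨a, haS, hca⟩ := exists_lt_of_lt_csSup ⟨0, h0S⟩ hδ
    have hac : a ≤ c := le_csSup hSbdd haS
    obtain ⟨K₀, hK₀⟩ := isCompact_Icc.exists_bound_of_continuousOn (hcont haS)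
    refine ⟨max K₀ (2 * (|Y a| + ∫ s in (0 : ℝ)..T, |r s|)), fun t ht => ?_⟩
    rcases le_total t a with hta | hat
    · exact (hK₀ t ⟨ht.1.le, hta⟩).trans (le_max_left _ _)
    refine le_trans ?_ (le_max_right _ _)
    have htS := hS_of_lt ht.1.le ht.2
    obtain ⟨x, hx, hxmax⟩ := isCompact_Icc.exists_isMaxOn (nonempty_Icc.2 hat)
      ((hcont htS).mono (Icc_subset_Icc haS.1.1 le_rfl)).abs
    have hxS := hS_mono htS (haS.1.1.trans hx.1) hx.2
    have hxT : x ≤ T := hxS.1.2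
    have hgi : IntervalIntegrable g volume a x := haS.2.symm.trans hxS.2
    have hri : IntervalIntegrable r volume a x := hr.mono_set (by
      rw [uIcc_of_le hx.1, uIcc_of_le hT]; exact Icc_subset_Icc haS.1.1 hxT)
    have hdiff : Y x = Y a + ∫ s in a..x, g s := by
      rw [hY x hxS.1, hY a haS.1, add_assoc, integral_add_adjacent_intervals haS.2 hgi]
    have hbound : |∫ s in a..x, g s| ≤ ∫ s in a..x, (M * |Y x| + |r s|) := by
      refine (abs_integral_le_integral_abs hx.1).trans
        (integral_mono_on hx.1 hgi.abs (intervalIntegrable_const.add hri.abs) fun s hs => ?_)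
      have hYs : |Y s| ≤ |Y x| := hxmax ⟨hs.1, hs.2.trans hx.2⟩
      have hbs := hb s ⟨haS.1.1.trans hs.1, hs.2.trans hxT⟩
      calc |g s| ≤ |b s| * |Y s| + |r s| := by
            rw [← abs_mul]; exact abs_add_le _ _
        _ ≤ M * |Y x| + |r s| := by gcongr
    rw [integral_add intervalIntegrable_const hri.abs, intervalIntegral.integral_const,
      smul_eq_mul] at hbound
    have hrT : ∫ s in a..x, |r s| ≤ ∫ s in (0 : ℝ)..T, |r s| :=
      integral_mono_interval haS.1.1 hx.1 hxT
        (Filter.Eventually.of_forall fun s => abs_nonneg _) hr.abs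
    have hsmall : (x - a) * (M * |Y x|) ≤ 1 / 2 * |Y x| := by
      have hxa : x - a ≤ 1 / (2 * (M + 1)) := by linarith [hx.2, ht.2]
      have hfac : (x - a) * M ≤ 1 / 2 := by
        calc (x - a) * M ≤ 1 / (2 * (M + 1)) * (M + 1) := by
              gcongr; linarith
          _ = 1 / 2 := by field_simp
      rw [← mul_assoc]
      exact mul_le_mul_of_nonneg_right hfac (abs_nonneg _)
    have htri : |Y x| ≤ |Y a| + |∫ s in a..x, g s| := by
      conv_lhs => rw [hdiff]
      exact abs_add_le _ _
    have hYt : |Y t| ≤ |Y x| := hxmax ⟨hat, le_rfl⟩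
    linarith
  have hleft : IntervalIntegrable g volume 0 c := by
    have hYc : ContinuousOn Y (Ioo 0 c) := fun t ht => by
      obtain ⟨u, htu, huc⟩ := exists_between ht.2
      exact ((hcont (hS_of_lt (ht.1.le.trans htu.le) huc)).continuousAt
        (Icc_mem_nhds ht.1 htu)).continuousWithinAt
    have hbY : IntegrableOn (fun s => b s * Y s) (Ioo 0 c) := by
      refine IntegrableOn.of_bound (C := M * K) measure_Ioo_lt_top
        (hb_meas.aestronglyMeasurable.mul (hYc.aestronglyMeasurable measurableSet_Ioo)) ?_
      filter_upwards [ae_restrict_mem measurableSet_Ioo] with s hs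
      rw [Real.norm_eq_abs, abs_mul]
      exact mul_le_mul (hb s ⟨hs.1.le, hs.2.le.trans hcT⟩) (hK s hs) (abs_nonneg _) hM
    refine IntervalIntegrable.add
      ((intervalIntegrable_iff_integrableOn_Ioo_of_le hc0).2 hbY) (hr.mono_set ?_)
    rw [uIcc_of_le hc0, uIcc_of_le hT]
    exact Icc_subset_Icc le_rfl hcT
  have hright : IntervalIntegrable g volume c T := by
    have hconst : ∀ t ∈ Ioc c T, Y t = y₀ := fun t ht => by
      have ht' : t ∈ Icc (0 : ℝ) T := ⟨hc0.trans ht.1.le, ht.2⟩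
      have hni : ¬ IntervalIntegrable g volume 0 t := fun h =>
        absurd (le_csSup hSbdd (show t ∈ S from ⟨ht', h⟩)) (not_le.2 ht.1)
      rw [hY t ht', intervalIntegral.integral_undef hni, add_zero]
    have hb' : IntegrableOn b (Ioc c T) := by
      refine IntegrableOn.of_bound (C := M) measure_Ioc_lt_top hb_meas.aestronglyMeasurable ?_
      filter_upwards [ae_restrict_mem measurableSet_Ioc] with s hs
      exact hb s ⟨hc0.trans hs.1.le, hs.2⟩
    have hr' : IntegrableOn r (Ioc c T) :=
      ((intervalIntegrable_iff_integrableOn_Ioc_of_le hT).1 hr).mono_set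
        (Ioc_subset_Ioc hc0 le_rfl)
    rw [intervalIntegrable_iff_integrableOn_Ioc_of_le hcT]
    refine IntegrableOn.congr_fun ((hb'.mul_const y₀).add hr') (fun s hs => ?_) measurableSet_Ioc
    simp only [hg, hconst s hs, Pi.add_apply]
  exact hleft.trans hright

/-- The sum of the impact cost and the spread cost of a trading path
`(J_0, q, J_T)` equals the reformulated quadratic expression. Here `Y_{T−} = Y T`
(continuous version) and the post-close impact state is `Y T + λ_T J_T`. -/
theorem cost_reformulation
    (T : ℝ) (hT : 0 < T) (lam0m y : ℝ) (hlam0m : 0 < lam0m)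
    (beta lam lam' eps : ℝ → ℝ)
    (hbeta_meas : Measurable beta) (heps_meas : Measurable eps)
    (hbeta_pos : ∀ t ∈ Icc (0:ℝ) T, 0 < beta t)
    (hbeta_bdd : ∃ M, ∀ t ∈ Icc (0:ℝ) T, |beta t| ≤ M)
    (heps_lb : ∃ c, 0 < c ∧ ∀ t ∈ Icc (0:ℝ) T, c ≤ eps t)
    (heps_ub : ∃ M, ∀ t ∈ Icc (0:ℝ) T, eps t ≤ M)
    (hlam_lb : ∃ c, 0 < c ∧ ∀ t ∈ Icc (0:ℝ) T, c ≤ lam t)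
    (hlam_ub : ∃ M, ∀ t ∈ Icc (0:ℝ) T, lam t ≤ M)
    (hlam_deriv : ∀ t, HasDerivAt lam (lam' t) t)
    (hlam'_bdd : ∃ M, ∀ t, |lam' t| ≤ M)
    (J0 JT : ℝ) (q : ℝ → ℝ) (hq_meas : Measurable q)
    (hq_sq : IntegrableOn (fun t => q t ^ 2) (Icc (0:ℝ) T))
    (Y : ℝ → ℝ) (hY0 : Y 0 = y + lam0m * J0)
    (hY : ∀ t ∈ Icc (0:ℝ) T,
        Y t = Y 0 + ∫ s in (0:ℝ)..t, (-beta s * Y s + lam s * q s))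
    :
    (1/2) * (y + Y 0) * J0 + (∫ t in (0:ℝ)..T, Y t * q t)
      + (1/2) * (Y T + (Y T + lam T * JT)) * JT
      + (1/2) * ∫ t in (0:ℝ)..T, eps t * q t ^ 2 =
    (1/2) * ((∫ t in (0:ℝ)..T, ((2 * beta t + lam' t / lam t) / lam t) * Y t ^ 2)
      + (∫ t in (0:ℝ)..T, eps t * q t ^ 2)
      + (Y T + lam T * JT) ^ 2 / lam T
      + (1 / lam0m - 1 / lam 0) * (Y 0) ^ 2
      - y ^ 2 / lam0m) := by
  obtain ⟨Mb, hMb⟩ := hbeta_bdd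
  obtain ⟨c, hc, hlam_c⟩ := hlam_lb
  obtain ⟨ML, hML⟩ := hlam'_bdd
  have hU : uIcc 0 T = Icc 0 T := uIcc_of_le hT.le
  have hlam_ne : ∀ t ∈ Icc (0 : ℝ) T, lam t ≠ 0 := fun t ht => (hc.trans_le (hlam_c t ht)).ne'
  have hlam_cont : Continuous lam :=
    continuous_iff_continuousAt.2 fun t => (hlam_deriv t).continuousAt
  have hlam'_meas : Measurable lam' := by
    rw [show lam' = deriv lam from funext fun t => (hlam_deriv t).deriv.symm]
    exact measurable_deriv lam
  have hq : IntervalIntegrable q volume 0 T := by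
    rw [intervalIntegrable_iff_integrableOn_Icc_of_le hT.le]
    exact ((memLp_two_iff_integrable_sq hq_meas.aestronglyMeasurable).2 hq_sq).integrable
      one_le_two
  set g : ℝ → ℝ := fun s => -beta s * Y s + lam s * q s with hg
  have hgi : IntervalIntegrable g volume 0 T :=
    intervalIntegrable_of_linear_volterra (b := fun s => -beta s) hT.le hbeta_meas.neg
      (fun t ht => by simpa only [abs_neg] using hMb t ht)
      (hq.continuousOn_mul hlam_cont.continuousOn) hY
  -- the primitive `Z` agrees with `Y` on `[0, T]`
  set Z : ℝ → ℝ := fun t => Y 0 + ∫ s in (0 : ℝ)..t, g s with hZ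
  have hYZ : ∀ t ∈ Icc (0 : ℝ) T, Y t = Z t := hY
  have hZac : AbsolutelyContinuousOnInterval Z 0 T :=
    (LipschitzWith.const (Y 0)).lipschitzOnWith.absolutelyContinuousOnInterval.fun_add
      (hgi.absolutelyContinuousOnInterval_intervalIntegral left_mem_uIcc)
  have hYcont : ContinuousOn Y (uIcc 0 T) :=
    hZac.continuousOn.congr fun t ht => hYZ t (hU ▸ ht)
  have hinv_deriv : ∀ t ∈ Icc (0 : ℝ) T,
      HasDerivAt (fun t => (lam t)⁻¹) (-lam' t / lam t ^ 2) t := fun t ht =>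
    (hlam_deriv t).fun_inv (hlam_ne t ht)
  have hinv_ac : AbsolutelyContinuousOnInterval (fun t => (lam t)⁻¹) 0 T := by
    refine LipschitzOnWith.absolutelyContinuousOnInterval (K := (ML / c ^ 2).toNNReal) ?_
    rw [hU]
    refine (convex_Icc 0 T).lipschitzOnWith_of_nnnorm_hasDerivWithin_le
      (fun t ht => (hinv_deriv t ht).hasDerivWithinAt) fun t ht => ?_
    rw [← NNReal.coe_le_coe, coe_nnnorm]
    refine le_trans ?_ (Real.le_coe_toNNReal _)
    rw [norm_div, norm_neg, norm_pow, Real.norm_eq_abs, Real.norm_eq_abs,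
      abs_of_pos (hc.trans_le (hlam_c t ht))]
    exact div_le_div₀ ((abs_nonneg _).trans (hML t)) (hML t) (by positivity)
      (pow_le_pow_left₀ hc.le (hlam_c t ht) 2)
  have hYq : IntervalIntegrable (fun t => Y t * q t) volume 0 T := hq.continuousOn_mul hYcont
  have hbeta_int : IntervalIntegrable beta volume 0 T := by
    rw [intervalIntegrable_iff_integrableOn_Icc_of_le hT.le]
    refine IntegrableOn.of_bound (C := Mb) measure_Icc_lt_top hbeta_meas.aestronglyMeasurable ?_
    filter_upwards [ae_restrict_mem measurableSet_Icc] with s hs using hMb s hs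
  have hlam'_int : IntervalIntegrable lam' volume 0 T := by
    rw [intervalIntegrable_iff_integrableOn_Icc_of_le hT.le]
    exact IntegrableOn.of_bound (C := ML) measure_Icc_lt_top hlam'_meas.aestronglyMeasurable
      (Filter.Eventually.of_forall hML)
  have hquad : IntervalIntegrable
      (fun t => ((2 * beta t + lam' t / lam t) / lam t) * Y t ^ 2) volume 0 T := by
    simp only [div_eq_mul_inv]
    exact (((hbeta_int.const_mul 2).add (hlam'_int.mul_continuousOn
      hinv_ac.continuousOn)).mul_continuousOn hinv_ac.continuousOn).mul_continuousOn (hYcont.pow 2)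
  have key : ∫ t in (0 : ℝ)..T,
      (2 * (Y t * q t) - ((2 * beta t + lam' t / lam t) / lam t) * Y t ^ 2) =
      Y T ^ 2 / lam T - Y 0 ^ 2 / lam 0 := by
    have hFTC := ((hZac.fun_mul hZac).fun_mul hinv_ac).integral_deriv_eq_sub
    rw [← hYZ T ⟨hT.le, le_rfl⟩, ← hYZ 0 ⟨le_rfl, hT.le⟩] at hFTC
    rw [div_eq_mul_inv, div_eq_mul_inv, sq, sq, ← hFTC]
    refine integral_congr_ae ?_
    filter_upwards [hgi.ae_hasDerivAt_integral] with t ht htU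
    have htI : t ∈ Icc (0 : ℝ) T := hU ▸ uIoc_subset_uIcc htU
    have hZd : HasDerivAt Z (g t) t :=
      (ht (uIoc_subset_uIcc htU) 0 left_mem_uIcc).const_add (Y 0)
    rw [((hZd.fun_mul hZd).fun_mul (hinv_deriv t htI)).deriv, ← hYZ t htI, hg]
    have hne := hlam_ne t htI
    field_simp
    ring
  rw [integral_sub (hYq.const_mul 2) hquad, intervalIntegral.integral_const_mul] at key
  have hlamT := hlam_ne T ⟨hT.le, le_rfl⟩
  have hopen : (1 / 2) * (y + Y 0) * J0 = (1 / 2) * (Y 0 ^ 2 / lam0m - y ^ 2 / lam0m) := by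
    rw [hY0]
    field_simp
    ring
  have hclose : (1 / 2) * (Y T + (Y T + lam T * JT)) * JT =
      (1 / 2) * ((Y T + lam T * JT) ^ 2 / lam T - Y T ^ 2 / lam T) := by
    field_simp
    ring
  have hstart : (1 / lam0m - 1 / lam 0) * Y 0 ^ 2 = Y 0 ^ 2 / lam0m - Y 0 ^ 2 / lam 0 := by
    ring
  rw [hopen, hclose, hstart]
  linarith
end

section
/- Closed-form solution for constant liquidity: let β, λ, ε ∈ (0,∞) be constants (so γ̇ ≡ 0) and let (A, B, C, D, E) solve the corresponding Riccati ODE system on [0,T]. Define f_t := −ε⁻¹(A_t + λ B_t), g_t := −ε⁻¹(B_t + λ C_t), h_t := −ε⁻¹(D_t + λ E_t). Then for all t ∈ [0,T]: f_t = f̃_t (e^{κ(T−t)} − 1)/d_t, g_t = g̃_t (e^{κ(T−t)} − 1)/d_t, and h_t = f_t (1 − e^{−∫_t^T θ_u du}). -/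
open Set MeasureTheory intervalIntegral

/-- The backward Riccati ODE system on `[0,T]` for constant liquidity parameters
`β, λ, ε` (so `γ̇ ≡ 0`), with a time-varying mean-reversion `θ`. -/
def IsRiccatiConst (T beta lam eps : ℝ) (theta : ℝ → ℝ) (A B C D E : ℝ → ℝ) : Prop :=
  (∀ t ∈ Icc (0:ℝ) T, HasDerivAt A (eps⁻¹ * (A t + lam * B t) ^ 2) t) ∧
  A T = lam ∧
  (∀ t ∈ Icc (0:ℝ) T,
      HasDerivAt B (eps⁻¹ * (A t + lam * B t) * (B t + lam * C t) + beta * B t) t) ∧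
  B T = -1 ∧
  (∀ t ∈ Icc (0:ℝ) T,
      HasDerivAt C (eps⁻¹ * (B t + lam * C t) ^ 2 + 2 * beta * C t - 2 * beta / lam) t) ∧
  C T = lam⁻¹ ∧
  (∀ t ∈ Icc (0:ℝ) T,
      HasDerivAt D (eps⁻¹ * (A t + lam * B t) * (D t + lam * E t)
        - theta t * (A t - D t)) t) ∧
  D T = 0 ∧
  (∀ t ∈ Icc (0:ℝ) T,
      HasDerivAt E (eps⁻¹ * (B t + lam * C t) * (D t + lam * E t)
        - theta t * (B t - E t) + beta * E t) t) ∧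
  E T = 0

/-- A differentiable curve on `[a, b]` whose derivative is bounded by a multiple of its norm
vanishes identically as soon as it vanishes at the right endpoint. -/
theorem eq_zero_of_norm_deriv_le_of_eq_zero_left {F : Type*} [NormedAddCommGroup F]
    [NormedSpace ℝ F] {r r' : ℝ → F} {K a b : ℝ}
    (hr : ∀ t ∈ Icc a b, HasDerivAt r (r' t) t) (hb : r b = 0)
    (bound : ∀ t ∈ Icc a b, ‖r' t‖ ≤ K * ‖r t‖) : ∀ t ∈ Icc a b, r t = 0 := by
  have hmem : ∀ s ∈ Icc 0 (b - a), b - s ∈ Icc a b := fun s hs =>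
    ⟨by linarith [hs.2], by linarith [hs.1]⟩
  have hrev : ∀ s ∈ Icc 0 (b - a), HasDerivAt (fun s => r (b - s)) (-r' (b - s)) s := by
    intro s hs
    simpa [Function.comp_def] using
      (hr _ (hmem s hs)).scomp s ((hasDerivAt_id s).const_sub b)
  have hzero := eq_zero_of_abs_deriv_le_mul_abs_self_of_eq_zero_right
    (f := fun s => r (b - s)) (f' := fun s => -r' (b - s)) (K := K) (a := 0) (b := b - a)
    (HasDerivAt.continuousOn hrev)
    (fun s hs => (hrev s (Ico_subset_Icc_self hs)).hasDerivWithinAt) (by simpa using hb)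
    (fun s hs => by simpa using bound _ (hmem s (Ico_subset_Icc_self hs)))
  intro t ht
  simpa using hzero (b - t) ⟨by linarith [ht.2], by linarith [ht.1]⟩

/-- Backward uniqueness for homogeneous linear systems with bounded coefficients. -/
theorem linear_system_eq_zero {ι : Type*} [Fintype ι] {M : ℝ → Matrix ι ι ℝ} {r : ℝ → ι → ℝ}
    {a b : ℝ} (hM : ∀ i j, ∃ K, ∀ t ∈ Icc a b, |M t i j| ≤ K)
    (hr : ∀ t ∈ Icc a b, ∀ i, HasDerivAt (fun s => r s i) (∑ j, M t i j * r t j) t)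
    (hb : r b = 0) : ∀ t ∈ Icc a b, r t = 0 := by
  choose K hK using hM
  refine eq_zero_of_norm_deriv_le_of_eq_zero_left (K := ∑ i, ∑ j, |K i j|)
    (fun t ht => hasDerivAt_pi.2 (hr t ht)) hb fun t ht => ?_
  refine (pi_norm_le_iff_of_nonneg (by positivity)).2 fun i => ?_
  calc ‖∑ j, M t i j * r t j‖ ≤ ∑ j, ‖M t i j * r t j‖ := norm_sum_le _ _
    _ ≤ ∑ j, |K i j| * ‖r t‖ := by
        refine Finset.sum_le_sum fun j _ => ?_
        rw [norm_mul]
        exact mul_le_mul ((hK i j t ht).trans (le_abs_self _)) (norm_le_pi_norm _ _)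
          (norm_nonneg _) (abs_nonneg _)
    _ = (∑ j, |K i j|) * ‖r t‖ := by rw [Finset.sum_mul]
    _ ≤ (∑ i, ∑ j, |K i j|) * ‖r t‖ := by
        refine mul_le_mul_of_nonneg_right ?_ (norm_nonneg _)
        exact Finset.single_le_sum (f := fun i => ∑ j, |K i j|)
          (fun i _ => by positivity) (Finset.mem_univ i)

/-- Linearization of the matrix Riccati equation for `(A, B, C)`: if `(d, a, b, c, m)` solves the
linear system satisfied by the Plücker coordinates and `(a, b, c, m) = d • (A, B, C, AC - B²)` at
the terminal time, then this relation persists. -/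
theorem riccati_eq_plucker {T beta lam e : ℝ} {A B C d a b c m : ℝ → ℝ}
    (hA : ∀ t ∈ Icc (0:ℝ) T, HasDerivAt A (e * (A t + lam * B t) ^ 2) t)
    (hB : ∀ t ∈ Icc (0:ℝ) T,
      HasDerivAt B (e * (A t + lam * B t) * (B t + lam * C t) + beta * B t) t)
    (hC : ∀ t ∈ Icc (0:ℝ) T,
      HasDerivAt C (e * (B t + lam * C t) ^ 2 + 2 * beta * C t - 2 * beta / lam) t)
    (hd : ∀ t, HasDerivAt d (-e * (a t + 2 * lam * b t + lam ^ 2 * c t) - beta * d t) t)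
    (ha : ∀ t, HasDerivAt a (-e * lam ^ 2 * m t - beta * a t) t)
    (hb : ∀ t, HasDerivAt b (e * lam * m t) t)
    (hc : ∀ t, HasDerivAt c (-e * m t + beta * c t - 2 * beta / lam * d t) t)
    (hm : ∀ t, HasDerivAt m (beta * m t - 2 * beta / lam * a t) t)
    (haT : a T = A T * d T) (hbT : b T = B T * d T) (hcT : c T = C T * d T)
    (hmT : m T = (A T * C T - B T ^ 2) * d T) :
    ∀ t ∈ Icc (0:ℝ) T, A t * d t = a t ∧ B t * d t = b t ∧ C t * d t = c t := by
  have hAc : ContinuousOn A (Icc 0 T) := HasDerivAt.continuousOn hA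
  have hBc : ContinuousOn B (Icc 0 T) := HasDerivAt.continuousOn hB
  have hCc : ContinuousOn C (Icc 0 T) := HasDerivAt.continuousOn hC
  let r : ℝ → Fin 4 → ℝ := fun t => ![A t * d t - a t, B t * d t - b t, C t * d t - c t,
    (A t * C t - B t ^ 2) * d t - m t]
  let M : ℝ → Matrix (Fin 4) (Fin 4) ℝ := fun t =>
    !![e * A t - beta, e * A t * (2 * lam), e * A t * lam ^ 2, -e * lam ^ 2;
       e * B t, e * B t * (2 * lam), e * B t * lam ^ 2, e * lam;
       e * C t, e * C t * (2 * lam), e * C t * lam ^ 2 + beta, -e;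
       e * (A t * C t - B t ^ 2) - 2 * beta / lam, e * (A t * C t - B t ^ 2) * (2 * lam),
         e * (A t * C t - B t ^ 2) * lam ^ 2, beta]
  have hM : ∀ i j, ∃ K, ∀ t ∈ Icc (0:ℝ) T, |M t i j| ≤ K := by
    intro i j
    refine isCompact_Icc.exists_bound_of_continuousOn (f := fun t => M t i j) ?_
    fin_cases i <;> fin_cases j <;> simp [M] <;> fun_prop
  have hr : ∀ t ∈ Icc (0:ℝ) T, ∀ i,
      HasDerivAt (fun s => r s i) (∑ j, M t i j * r t j) t := by
    intro t ht i
    have hA := hA t ht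
    have hB := hB t ht
    have hC := hC t ht
    fin_cases i
    · refine ((hA.mul (hd t)).sub (ha t)).congr_deriv ?_
      simp [M, r, Fin.sum_univ_four]
      ring
    · refine ((hB.mul (hd t)).sub (hb t)).congr_deriv ?_
      simp [M, r, Fin.sum_univ_four]
      ring
    · refine ((hC.mul (hd t)).sub (hc t)).congr_deriv ?_
      simp [M, r, Fin.sum_univ_four]
      ring
    · refine ((((hA.mul hC).sub (hB.pow 2)).mul (hd t)).sub (hm t)).congr_deriv ?_
      simp [M, r, Fin.sum_univ_four]
      ring
  have hrT : r T = 0 := by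
    ext i
    fin_cases i <;> simp [r, haT, hbT, hcT, hmT]
  intro t ht
  have hrt := linear_system_eq_zero hM hr hrT t ht
  have h0 := congrFun hrt 0
  have h1 := congrFun hrt 1
  have h2 := congrFun hrt 2
  simp [r] at h0 h1 h2
  exact ⟨by linarith, by linarith, by linarith⟩

/-- A solution `p` of the scalar equation `p' = θ p` with `p T = 1` is the exponential of
`-∫ θ`, even when `θ` is merely bounded and measurable. -/
theorem eq_exp_neg_integral_of_hasDerivAt {T : ℝ} {theta p : ℝ → ℝ} (hmeas : Measurable theta)
    (hbdd : ∃ K, ∀ t ∈ Icc (0:ℝ) T, |theta t| ≤ K)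
    (hp : ∀ t ∈ Icc (0:ℝ) T, HasDerivAt p (theta t * p t) t) (hpT : p T = 1) :
    ∀ t ∈ Icc (0:ℝ) T, p t = Real.exp (-∫ u in t..T, theta u) := by
  obtain ⟨K, hK⟩ := hbdd
  have hpc : ContinuousOn p (Icc 0 T) := HasDerivAt.continuousOn hp
  have hne : ∀ t ∈ Icc (0:ℝ) T, p t ≠ 0 := by
    intro t ht h0
    have hsub : Icc t T ⊆ Icc 0 T := Icc_subset_Icc_left ht.1
    have := eq_zero_of_abs_deriv_le_mul_abs_self_of_eq_zero_right (K := K)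
      (hpc.mono hsub)
      (fun s hs => (hp s (hsub (Ico_subset_Icc_self hs))).hasDerivWithinAt) h0
      (fun s hs => by
        rw [norm_mul]
        exact mul_le_mul_of_nonneg_right (hK s (hsub (Ico_subset_Icc_self hs))) (norm_nonneg _))
      T ⟨ht.2, le_rfl⟩
    rw [hpT] at this
    exact one_ne_zero this
  intro t ht
  have hsub : Icc t T ⊆ Icc 0 T := Icc_subset_Icc_left ht.1
  have hpos : 0 < p t := by
    by_contra! hle
    obtain ⟨s, hs, hs0⟩ := intermediate_value_Icc ht.2 (hpc.mono hsub)
      (show (0:ℝ) ∈ Icc (p t) (p T) from ⟨hle, by rw [hpT]; exact zero_le_one⟩)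
    exact hne s (hsub hs) hs0
  have hint : IntervalIntegrable theta volume t T := by
    rw [intervalIntegrable_iff_integrableOn_Icc_of_le ht.2]
    exact Measure.integrableOn_of_bounded (M := K) (by simp) hmeas.aestronglyMeasurable
      ((ae_restrict_iff' measurableSet_Icc).2 (.of_forall fun s hs => hK s (hsub hs)))
  have hlog : ∫ u in t..T, theta u = Real.log (p T) - Real.log (p t) := by
    refine integral_eq_sub_of_hasDerivAt (f := fun s => Real.log (p s)) (fun s hs => ?_) hint
    rw [uIcc_of_le ht.2] at hs
    have hs' := hsub hs
    exact ((hp s hs').log (hne s hs')).congr_deriv (mul_div_cancel_right₀ _ (hne s hs'))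
  rw [hlog, hpT, Real.log_one, zero_sub, neg_neg, Real.exp_log hpos]

/-- The inhomogeneous components `(D, E)` are `(A, B)` times `1 - exp (-∫ θ)`. -/
theorem riccati_linear_part {T beta lam eps : ℝ} (hlam : 0 < lam) {theta A B C D E : ℝ → ℝ}
    (hmeas : Measurable theta) (hbdd : ∃ K, ∀ t ∈ Icc (0:ℝ) T, |theta t| ≤ K)
    (hsol : IsRiccatiConst T beta lam eps theta A B C D E)
    (hpos : ∀ t ∈ Icc (0:ℝ) T, 0 < A t) :
    ∀ t ∈ Icc (0:ℝ) T, D t = A t * (1 - Real.exp (-∫ u in t..T, theta u)) ∧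
      E t = B t * (1 - Real.exp (-∫ u in t..T, theta u)) := by
  obtain ⟨hA, hAT, hB, hBT, hC, hCT, hD, hDT, hE, hET⟩ := hsol
  have hAc : ContinuousOn A (Icc 0 T) := HasDerivAt.continuousOn hA
  have hBc : ContinuousOn B (Icc 0 T) := HasDerivAt.continuousOn hB
  have hCc : ContinuousOn C (Icc 0 T) := HasDerivAt.continuousOn hC
  have hwronskian : ∀ t ∈ Icc (0:ℝ) T, (A t - D t) * B t - (B t - E t) * A t = 0 := by
    obtain ⟨K, hK⟩ := hbdd
    obtain ⟨L, hL⟩ := isCompact_Icc.exists_bound_of_continuousOn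
      (show ContinuousOn (fun t => eps⁻¹ * (A t + lam * B t) + eps⁻¹ * lam * (B t + lam * C t)
        + beta) (Icc 0 T) by fun_prop)
    refine eq_zero_of_norm_deriv_le_of_eq_zero_left (K := L + K)
      (r' := fun t => (eps⁻¹ * (A t + lam * B t) + eps⁻¹ * lam * (B t + lam * C t) + beta
        + theta t) * ((A t - D t) * B t - (B t - E t) * A t)) (fun t ht => ?_)
      (by rw [hAT, hBT, hDT, hET]; ring) (fun t ht => ?_)
    · refine ((((hA t ht).sub (hD t ht)).mul (hB t ht)).sub
        (((hB t ht).sub (hE t ht)).mul (hA t ht))).congr_deriv ?_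
      simp only [Pi.sub_apply]
      ring
    · rw [norm_mul]
      exact mul_le_mul_of_nonneg_right
        ((norm_add_le _ _).trans (add_le_add (hL t ht) (hK t ht))) (norm_nonneg _)
  have hquot := eq_exp_neg_integral_of_hasDerivAt (p := fun t => (A t - D t) / A t) hmeas hbdd
    (fun t ht => by
      have hne := (hpos t ht).ne'
      refine (((hA t ht).sub (hD t ht)).div (hA t ht) hne).congr_deriv ?_
      have hw := hwronskian t ht
      simp only [Pi.sub_apply]
      rw [div_eq_iff (pow_ne_zero 2 hne)]
      have : theta t * ((A t - D t) / A t) * A t ^ 2 = theta t * (A t - D t) * A t := by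
        field_simp
      rw [this]
      linear_combination -eps⁻¹ * (A t + lam * B t) * lam * hw)
    (by simp [hDT, hAT, hlam.ne'])
  intro t ht
  have hne := (hpos t ht).ne'
  rw [← hquot t ht]
  refine ⟨by field_simp; ring, ?_⟩
  have hw := hwronskian t ht
  field_simp
  linear_combination hw

/-- Closed form of `(A, B, C)` up to the positive factor `d`, in the parametrization
`ε = 2 λ β / (κ² - β²)`. -/
theorem riccati_quadratic_part {T beta kappa lam eps : ℝ} (hbeta : 0 < beta)
    (hkappa : beta < kappa) (hlam : 0 < lam)
    (heps : eps = 2 * lam * beta / ((kappa - beta) * (kappa + beta)))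
    {theta A B C D E : ℝ → ℝ} (hsol : IsRiccatiConst T beta lam eps theta A B C D E)
    {X Y d F G : ℝ → ℝ} (hX : ∀ t, X t = Real.exp (kappa * (T - t)))
    (hY : ∀ t, Y t = Real.exp (-kappa * (T - t)))
    (hd : ∀ t, d t =
        X t * ((kappa - beta)⁻¹ * ((kappa - beta)⁻¹ + beta⁻¹ - kappa⁻¹) + beta⁻¹ * kappa⁻¹)
      + Y t * ((kappa + beta)⁻¹ * (-(kappa + beta)⁻¹ + beta⁻¹ + kappa⁻¹) + beta⁻¹ * kappa⁻¹)
      + (T - t) * X t * (kappa - beta)⁻¹ + (T - t) * Y t * (kappa + beta)⁻¹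
      + 4 * (beta ^ 2 / ((kappa - beta) * (kappa + beta))) * beta⁻¹ * kappa⁻¹)
    (hF : ∀ t, F t = (kappa - beta)⁻¹ + (kappa + beta)⁻¹
      - (beta⁻¹ + (kappa - beta)⁻¹) * X t + (beta⁻¹ - (kappa + beta)⁻¹) * Y t)
    (hG : ∀ t, G t = lam⁻¹ * (F t - (X t - Y t) * (T - t)
      + 2 * kappa⁻¹ * (X t + Y t - 2))) :
    ∀ t ∈ Icc (0:ℝ) T, 0 < d t ∧ 0 < A t ∧
      -eps⁻¹ * (A t + lam * B t) * d t = F t ∧ -eps⁻¹ * (B t + lam * C t) * d t = G t := by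
  obtain ⟨hA, hAT, hB, hBT, hC, hCT, -⟩ := hsol
  have hk : 0 < kappa := hbeta.trans hkappa
  have hu : 0 < kappa - beta := sub_pos.2 hkappa
  have hv : 0 < kappa + beta := by positivity
  have hu0 := hu.ne'
  have hv0 := hv.ne'
  have hb0 := hbeta.ne'
  have hk0 := hk.ne'
  have hl0 := hlam.ne'
  have he : 0 < eps := by rw [heps]; positivity
  have hX' : ∀ t, HasDerivAt X (-kappa * X t) t := fun t => by
    rw [hX, funext hX]
    exact (((hasDerivAt_id t).const_sub T).const_mul kappa).exp.congr_deriv (by simp; ring)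
  have hY' : ∀ t, HasDerivAt Y (kappa * Y t) t := fun t => by
    rw [hY, funext hY]
    exact (((hasDerivAt_id t).const_sub T).const_mul (-kappa)).exp.congr_deriv (by simp; ring)
  have hs' : ∀ t, HasDerivAt (fun t => T - t) (-1) t := fun t => (hasDerivAt_id t).const_sub T
  have hXT : X T = 1 := by simp [hX]
  have hYT : Y T = 1 := by simp [hY]
  have hXpos : ∀ t, 0 < X t := fun t => by rw [hX]; exact Real.exp_pos _
  have hYpos : ∀ t, 0 < Y t := fun t => by rw [hY]; exact Real.exp_pos _
  have hF' : ∀ t, HasDerivAt F (kappa * (beta⁻¹ + (kappa - beta)⁻¹) * X t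
      + kappa * (beta⁻¹ - (kappa + beta)⁻¹) * Y t) t := fun t => by
    rw [funext hF]
    exact ((((hX' t).const_mul (beta⁻¹ + (kappa - beta)⁻¹)).const_sub _).add
      ((hY' t).const_mul _)).congr_deriv (by ring)
  have hG' : ∀ t, HasDerivAt G (lam⁻¹ * (kappa * (beta⁻¹ + (kappa - beta)⁻¹) * X t
      + kappa * (beta⁻¹ - (kappa + beta)⁻¹) * Y t + kappa * (X t + Y t) * (T - t)
      + (X t - Y t) - 2 * (X t - Y t))) t := fun t => by
    rw [funext hG]
    refine ((((hF' t).sub (((hX' t).sub (hY' t)).mul (hs' t))).add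
      ((((hX' t).add (hY' t)).sub_const 2).const_mul (2 * kappa⁻¹))).const_mul
        lam⁻¹).congr_deriv ?_
    simp only [Pi.sub_apply]
    field_simp
    ring
  set d₀ : ℝ := 4 * kappa ^ 3 / (beta * ((kappa - beta) * (kappa + beta)) ^ 2) with hd₀
  have hd₀pos : 0 < d₀ := by positivity
  have hdT : d T = d₀ := by
    rw [hd, hXT, hYT, hd₀]
    field_simp
    ring
  let a : ℝ → ℝ := fun t =>
    lam * d₀ / (2 * kappa) * ((kappa + beta) * X t + (kappa - beta) * Y t)
  let m : ℝ → ℝ := fun t => beta * d₀ / kappa * (X t - Y t)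
  let b : ℝ → ℝ := fun t => (-eps * F t - a t) / lam
  let c : ℝ → ℝ := fun t => (-eps * G t - b t) / lam
  have ha' : ∀ t, HasDerivAt a (-eps⁻¹ * lam ^ 2 * m t - beta * a t) t := fun t => by
    refine ((((hX' t).const_mul (kappa + beta)).add ((hY' t).const_mul
      (kappa - beta))).const_mul (lam * d₀ / (2 * kappa))).congr_deriv ?_
    simp only [a, m, heps]
    field_simp
    ring
  have hm' : ∀ t, HasDerivAt m (beta * m t - 2 * beta / lam * a t) t := fun t => by
    refine (((hX' t).sub (hY' t)).const_mul (beta * d₀ / kappa)).congr_deriv ?_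
    simp only [a, m]
    field_simp
    ring
  have hb' : ∀ t, HasDerivAt b (eps⁻¹ * lam * m t) t := fun t => by
    refine ((((hF' t).const_mul (-eps)).sub (ha' t)).div_const lam).congr_deriv ?_
    simp only [a, m, heps, hd₀]
    field_simp
    ring
  have hc' : ∀ t, HasDerivAt c (-eps⁻¹ * m t + beta * c t - 2 * beta / lam * d t) t :=
    fun t => by
    refine ((((hG' t).const_mul (-eps)).sub (hb' t)).div_const lam).congr_deriv ?_
    simp only [a, b, c, m, hd, hG, hF, heps, hd₀]
    field_simp
    ring
  have hd' : ∀ t, HasDerivAt d (-eps⁻¹ * (a t + 2 * lam * b t + lam ^ 2 * c t)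
      - beta * d t) t := fun t => by
    have hFG : -eps⁻¹ * (a t + 2 * lam * b t + lam ^ 2 * c t) = F t + lam * G t := by
      simp only [b, c]
      field_simp
      ring
    rw [hFG, funext hd]
    refine ((((((hX' t).mul_const _).add ((hY' t).mul_const _)).add
      (((hs' t).mul (hX' t)).mul_const _)).add
      (((hs' t).mul (hY' t)).mul_const _)).add_const _).congr_deriv ?_
    simp only [hG, hF]
    field_simp
    ring
  have haT : a T = A T * d T := by
    simp only [a, hXT, hYT, hAT, hdT]
    field_simp
    ring
  have hbT : b T = B T * d T := by
    simp only [b, a, hF, hXT, hYT, hBT, hdT, heps]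
    field_simp
    ring
  have hcT : c T = C T * d T := by
    have hGT : G T = 0 := by
      rw [hG, hF, hXT, hYT]
      ring
    simp only [c, hbT, hGT, hCT, hBT]
    field_simp
    ring
  have hmT : m T = (A T * C T - B T ^ 2) * d T := by
    simp [m, hXT, hYT, hAT, hBT, hCT, hl0]
  intro t ht
  obtain ⟨hAd, hBd, hCd⟩ :=
    riccati_eq_plucker hA hB hC hd' ha' hb' hc' hm' haT hbT hcT hmT t ht
  have hdpos : 0 < d t := by
    have hs : 0 ≤ T - t := sub_nonneg.2 ht.2
    have h1 : 0 < beta⁻¹ - kappa⁻¹ := sub_pos.2 (inv_strictAnti₀ hbeta hkappa)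
    have h2 : 0 < beta⁻¹ - (kappa + beta)⁻¹ :=
      sub_pos.2 (inv_strictAnti₀ hbeta (by linarith))
    have h3 : 0 < (kappa - beta)⁻¹ + beta⁻¹ - kappa⁻¹ := by
      rw [add_sub_assoc]; positivity
    have h4 : 0 < -(kappa + beta)⁻¹ + beta⁻¹ + kappa⁻¹ := by
      rw [neg_add_eq_sub]; positivity
    have := hXpos t
    have := hYpos t
    rw [hd]
    positivity
  have hapos : 0 < a t := by
    have := hXpos t
    have := hYpos t
    positivity
  refine ⟨hdpos, pos_of_mul_pos_left (hAd ▸ hapos) hdpos.le, ?_, ?_⟩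
  · have : -eps⁻¹ * (A t + lam * B t) * d t = -eps⁻¹ * (A t * d t + lam * (B t * d t)) := by
      ring
    rw [this, hAd, hBd]
    simp only [b]
    field_simp
    ring
  · have : -eps⁻¹ * (B t + lam * C t) * d t = -eps⁻¹ * (B t * d t + lam * (C t * d t)) := by
      ring
    rw [this, hBd, hCd]
    simp only [c]
    field_simp
    ring

/-- **Closed form for constant liquidity.** With constants
`β, λ, ε > 0`, `ε̃ = εβ/(2λ)` and `κ = β√(1 + 1/ε̃)`, the feedback coefficients satisfy
`f_t = f̃_t (e^{κ(T−t)} − 1)/d_t`, `g_t = g̃_t (e^{κ(T−t)} − 1)/d_t` and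
`h_t = f_t (1 − e^{−∫_t^T θ_u du})` on `[0,T]`. -/
theorem closed_form_constant_liquidity
    (T beta lam eps : ℝ) (hT : 0 < T) (hbeta : 0 < beta) (hlam : 0 < lam) (heps : 0 < eps)
    (theta : ℝ → ℝ) (htheta_meas : Measurable theta)
    (htheta_bdd : ∃ M, ∀ t ∈ Icc (0:ℝ) T, |theta t| ≤ M)
    (epsTil kappa : ℝ) (hepsTil : epsTil = eps * beta / (2 * lam))
    (hkappa : kappa = beta * Real.sqrt (1 + epsTil⁻¹))
    (A B C D E : ℝ → ℝ) (hsol : IsRiccatiConst T beta lam eps theta A B C D E)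
    (f g h ftil gtil d : ℝ → ℝ)
    (hf : ∀ t, f t = -eps⁻¹ * (A t + lam * B t))
    (hg : ∀ t, g t = -eps⁻¹ * (B t + lam * C t))
    (hh : ∀ t, h t = -eps⁻¹ * (D t + lam * E t))
    (hftil : ∀ t, ftil t = -(beta⁻¹ - (kappa + beta)⁻¹) * Real.exp (-kappa * (T - t))
        - (beta⁻¹ + (kappa - beta)⁻¹))
    (hgtil : ∀ t, gtil t = lam⁻¹ * ftil t
        - lam⁻¹ * (1 + Real.exp (-kappa * (T - t))) * (T - t)
        + 2 * lam⁻¹ * kappa⁻¹ * (1 - Real.exp (-kappa * (T - t))))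
    (hd : ∀ t, d t =
        Real.exp (kappa * (T - t)) *
          ((kappa - beta)⁻¹ * ((kappa - beta)⁻¹ + beta⁻¹ - kappa⁻¹) + beta⁻¹ * kappa⁻¹)
      + Real.exp (-kappa * (T - t)) *
          ((kappa + beta)⁻¹ * (-(kappa + beta)⁻¹ + beta⁻¹ + kappa⁻¹) + beta⁻¹ * kappa⁻¹)
      + (T - t) * Real.exp (kappa * (T - t)) * (kappa - beta)⁻¹
      + (T - t) * Real.exp (-kappa * (T - t)) * (kappa + beta)⁻¹
      + 4 * epsTil * beta⁻¹ * kappa⁻¹) :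
    ∀ t ∈ Icc (0:ℝ) T,
      f t = ftil t * (Real.exp (kappa * (T - t)) - 1) / d t ∧
      g t = gtil t * (Real.exp (kappa * (T - t)) - 1) / d t ∧
      h t = f t * (1 - Real.exp (-(∫ u in t..T, theta u))) := by
  have hepsTil_pos : 0 < epsTil := by rw [hepsTil]; positivity
  have hsq : kappa ^ 2 = beta ^ 2 * (1 + epsTil⁻¹) := by
    rw [hkappa, mul_pow, Real.sq_sqrt (by positivity)]
  have hlt : beta < kappa := by
    rw [hkappa]
    refine lt_mul_of_one_lt_right hbeta (Real.lt_sqrt_of_sq_lt ?_)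
    rw [one_pow]
    exact lt_add_of_pos_right 1 (inv_pos.2 hepsTil_pos)
  have hprod : (kappa - beta) * (kappa + beta) = beta ^ 2 / epsTil := by
    rw [div_eq_mul_inv]
    linear_combination hsq
  have hepsTil' : epsTil = beta ^ 2 / ((kappa - beta) * (kappa + beta)) := by
    rw [hprod]
    field_simp
  have heps' : eps = 2 * lam * beta / ((kappa - beta) * (kappa + beta)) := by
    rw [hprod, hepsTil]
    field_simp
  have hquad := riccati_quadratic_part (d := d) hbeta hlt hlam heps' hsol
    (fun _ => rfl) (fun _ => rfl)
    (fun t => by rw [hd t, hepsTil']) (fun _ => rfl) (fun _ => rfl)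
  intro t ht
  obtain ⟨hdpos, -, hfd, hgd⟩ := hquad t ht
  have hXY : Real.exp (kappa * (T - t)) * Real.exp (-kappa * (T - t)) = 1 := by
    rw [← Real.exp_add]
    simp
  refine ⟨?_, ?_, ?_⟩
  · rw [eq_div_iff hdpos.ne', hf, hfd, hftil]
    linear_combination (beta⁻¹ - (kappa + beta)⁻¹) * hXY
  · rw [eq_div_iff hdpos.ne', hg, hgd, hgtil, hftil]
    linear_combination lam⁻¹ * (beta⁻¹ - (kappa + beta)⁻¹ + (T - t) + 2 * kappa⁻¹) * hXY
  · obtain ⟨hD, hE⟩ := riccati_linear_part hlam htheta_meas htheta_bdd hsol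
      (fun s hs => (hquad s hs).2.1) t ht
    rw [hh, hf, hD, hE]
    ring
end

section
/- Determinant identity: with constants β, λ, ε ∈ (0,∞), ε̃ := εβ/(2λ) and κ := β√(1 + 1/ε̃) > β, the 2×2 matrix M_t with entries a^{11}_t, a^{12}_t, a^{21}_t, a^{22}_t satisfies det(M_t) = a^{11}_t a^{22}_t − a^{12}_t a^{21}_t = d_t for every t ∈ [0, T], where d_t is the explicit expression given below; in particular M_t is invertible with positive determinant. -/
open Set Matrix

/-- The constant term in the expansion of the determinant. -/
theorem inv_combination_eq {β κ e : ℝ} (hβ : 0 < β) (hlt : β < κ)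
    (hsq : e * (κ ^ 2 - β ^ 2) = β ^ 2) :
    κ⁻¹ * ((κ - β)⁻¹ - (κ + β)⁻¹) + β⁻¹ * ((κ - β)⁻¹ + (κ + β)⁻¹) - 2 * β⁻¹ * κ⁻¹
      = 4 * e * β⁻¹ * κ⁻¹ := by
  have hκ : 0 < κ := hβ.trans hlt
  have hsub : κ - β ≠ 0 := (sub_pos.mpr hlt).ne'
  have hadd : κ + β ≠ 0 := by positivity
  field_simp
  linear_combination (-4) * hsq

/-- **Determinant identity.** With constants `β, λ, ε > 0`,
`ε̃ = εβ/(2λ)` and `κ = β√(1 + 1/ε̃) > β`, the 2×2 matrix `M_t` with entries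
`a^{11}_t, a^{12}_t, a^{21}_t, a^{22}_t` satisfies
`det(M_t) = a^{11}_t a^{22}_t − a^{12}_t a^{21}_t = d_t` for every `t ∈ [0,T]`;
in particular `M_t` is invertible with positive determinant. -/
theorem determinant_identity
    (T beta lam eps : ℝ) (hT : 0 < T) (hbeta : 0 < beta) (hlam : 0 < lam) (heps : 0 < eps)
    (epsTil kappa : ℝ) (hepsTil : epsTil = eps * beta / (2 * lam))
    (hkappa : kappa = beta * Real.sqrt (1 + epsTil⁻¹))
    (a11 a12 a21 a22 d : ℝ → ℝ)
    (ha11 : ∀ t, a11 t = kappa⁻¹ * Real.exp (kappa * (T - t)) - (T - t)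
        + ((kappa + beta)⁻¹ - beta⁻¹ - kappa⁻¹))
    (ha12 : ∀ t, a12 t = -kappa⁻¹ * Real.exp (-kappa * (T - t)) - (T - t)
        + (-(kappa - beta)⁻¹ - beta⁻¹ + kappa⁻¹))
    (ha21 : ∀ t, a21 t = Real.exp (kappa * (T - t)) * (kappa - beta)⁻¹ + beta⁻¹)
    (ha22 : ∀ t, a22 t = -Real.exp (-kappa * (T - t)) * (kappa + beta)⁻¹ + beta⁻¹)
    (hd : ∀ t, d t =
        Real.exp (kappa * (T - t)) *
          ((kappa - beta)⁻¹ * ((kappa - beta)⁻¹ + beta⁻¹ - kappa⁻¹) + beta⁻¹ * kappa⁻¹)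
      + Real.exp (-kappa * (T - t)) *
          ((kappa + beta)⁻¹ * (-(kappa + beta)⁻¹ + beta⁻¹ + kappa⁻¹) + beta⁻¹ * kappa⁻¹)
      + (T - t) * Real.exp (kappa * (T - t)) * (kappa - beta)⁻¹
      + (T - t) * Real.exp (-kappa * (T - t)) * (kappa + beta)⁻¹
      + 4 * epsTil * beta⁻¹ * kappa⁻¹) :
    ∀ t ∈ Icc (0:ℝ) T,
      (!![a11 t, a12 t; a21 t, a22 t] : Matrix (Fin 2) (Fin 2) ℝ).det
          = a11 t * a22 t - a12 t * a21 t ∧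
      (!![a11 t, a12 t; a21 t, a22 t] : Matrix (Fin 2) (Fin 2) ℝ).det = d t ∧
      0 < (!![a11 t, a12 t; a21 t, a22 t] : Matrix (Fin 2) (Fin 2) ℝ).det ∧
      IsUnit (!![a11 t, a12 t; a21 t, a22 t] : Matrix (Fin 2) (Fin 2) ℝ) := by
  intro t ht
  have hs : 0 ≤ T - t := sub_nonneg.mpr ht.2
  have hepsTil_pos : 0 < epsTil := by rw [hepsTil]; positivity
  have hlt : beta < kappa := by
    rw [hkappa]
    refine lt_mul_of_one_lt_right hbeta (Real.lt_sqrt_of_sq_lt ?_)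
    simpa using hepsTil_pos
  have hkappa_pos : 0 < kappa := hbeta.trans hlt
  have hsub : 0 < kappa - beta := sub_pos.mpr hlt
  have hsq : epsTil * (kappa ^ 2 - beta ^ 2) = beta ^ 2 := by
    rw [hkappa, mul_pow, Real.sq_sqrt (by positivity)]
    field_simp
    ring
  have hexp : Real.exp (kappa * (T - t)) * Real.exp (-kappa * (T - t)) = 1 := by
    rw [← Real.exp_add]
    simp
  have hconst := inv_combination_eq hbeta hlt hsq
  have hdet : (!![a11 t, a12 t; a21 t, a22 t] : Matrix (Fin 2) (Fin 2) ℝ).det = d t := by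
    rw [det_fin_two_of, ha11, ha12, ha21, ha22, hd]
    linear_combination
      (kappa⁻¹ * ((kappa - beta)⁻¹ - (kappa + beta)⁻¹)) * hexp + hconst
  have hpos : 0 < d t := by
    have hinv_sub : 0 < (kappa - beta)⁻¹ - kappa⁻¹ :=
      sub_pos.mpr (inv_strictAnti₀ hsub (by linarith))
    have hinv_add : 0 < beta⁻¹ - (kappa + beta)⁻¹ :=
      sub_pos.mpr (inv_strictAnti₀ hbeta (by linarith))
    have hcoeff_exp : 0 < (kappa - beta)⁻¹ + beta⁻¹ - kappa⁻¹ := by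
      have := inv_pos.mpr hbeta
      linarith
    have hcoeff_exp_neg : 0 < -(kappa + beta)⁻¹ + beta⁻¹ + kappa⁻¹ := by
      have := inv_pos.mpr hkappa_pos
      linarith
    rw [hd]
    positivity
  refine ⟨det_fin_two_of _ _ _ _, hdet, hdet ▸ hpos, ?_⟩
  rw [isUnit_iff_isUnit_det, hdet]
  exact hpos.ne'.isUnit
end

section
/- Deterministic maximum principle solution: fix constants β, λ, ε ∈ (0,∞), a bounded measurable θ : [0,T] → ℝ, an initial time t ∈ [0,T) and initial states (x, y, z) ∈ ℝ³. Let (C¹_t, C²_t) be the unique solution of the linear system M_t (C¹_t, C²_t)ᵀ = (−x̄, −y/λ)ᵀ, where x̄ := x + (1 − e^{−∫_t^T θ_u du}) z, and define q*_s := C¹_t e^{κ(T−s)} + C²_t e^{−κ(T−s)} − (C¹_t + C²_t) for s ∈ [t,T] (so q*_T = 0). Let the state trajectories (X_s, Y_s, Z_s) on [t,T] solve Ż_s = −θ_s Z_s, Z_t = z; Ẋ_s = q*_s + θ_s Z_s, X_t = x; Ẏ_s = −β Y_s + λ q*_s, Y_t = y. Then there exist absolutely continuous adjoint functions U^X, U^Y,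 U^Z on [t,T] satisfying the backward system −U̇^X_s = 0 with U^X_T = λ X_T − Y_T; −U̇^Y_s = −β U^Y_s + (2β/λ) Y_s with U^Y_T = −X_T + Y_T/λ; −U̇^Z_s = θ_s (U^X_s − U^Z_s) with U^Z_T = 0; together with the optimality condition U^X_s + λ U^Y_s + ε q*_s = 0 for all s ∈ [t,T]. -/
open Set MeasureTheory intervalIntegral

/-- The exponential of an absolutely continuous function is absolutely continuous. -/
lemma AbsolutelyContinuousOnInterval.real_exp {g : ℝ → ℝ} {a b : ℝ}
    (hg : AbsolutelyContinuousOnInterval g a b) :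
    AbsolutelyContinuousOnInterval (fun s ↦ Real.exp (g s)) a b := by
  obtain ⟨C, hC⟩ := hg.exists_bound
  obtain ⟨K, hK⟩ := (Real.contDiff_exp (n := 1)).contDiffOn.exists_lipschitzOnWith
    (s := Icc (-C) C) (by simp) (convex_Icc _ _) isCompact_Icc
  rw [absolutelyContinuousOnInterval_iff] at hg ⊢
  intro ε hε
  obtain ⟨δ, hδ, h⟩ := hg (ε / (K + 1)) (by positivity)
  refine ⟨δ, hδ, fun E hE hlen ↦ ?_⟩
  have hmem : ∀ s ∈ uIcc a b, g s ∈ Icc (-C) C := fun s hs ↦ abs_le.mp (hC s hs)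
  calc
    _ ≤ ∑ i ∈ Finset.range E.1, (K + 1 : ℝ) * dist (g (E.2 i).1) (g (E.2 i).2) := by
      refine Finset.sum_le_sum fun i hi ↦ ?_
      have hi' := hE.1 i hi
      refine (hK.dist_le_mul _ (hmem _ hi'.1) _ (hmem _ hi'.2)).trans ?_
      gcongr
      linarith
    _ = (K + 1) * ∑ i ∈ Finset.range E.1, dist (g (E.2 i).1) (g (E.2 i).2) := by
      rw [Finset.mul_sum]
    _ < (K + 1) * (ε / (K + 1)) := by
      gcongr
      exact h E hE hlen
    _ = ε := by field_simp

lemma intervalIntegral_mul_exp_integral {f : ℝ → ℝ} {a b c : ℝ}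
    (hf : IntervalIntegrable f volume a b) (hc : c ∈ uIcc a b) :
    ∫ u in a..b, f u * Real.exp (∫ v in c..u, f v)
      = Real.exp (∫ v in c..b, f v) - Real.exp (∫ v in c..a, f v) := by
  rw [← (hf.absolutelyContinuousOnInterval_intervalIntegral hc).real_exp.integral_deriv_eq_sub]
  apply intervalIntegral.integral_congr_ae
  filter_upwards [hf.ae_hasDerivAt_integral] with u hu hmem
  rw [(hu (uIoc_subset_uIcc hmem) c hc).exp.deriv, mul_comm]

/-- The variation of constants formula for the linear integral equation `W = w + ∫ (a W + b)`. -/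
noncomputable def variationOfConstants (a b : ℝ → ℝ) (t w s : ℝ) : ℝ :=
  Real.exp (∫ v in t..s, a v) * (w + ∫ u in t..s, b u * Real.exp (-∫ v in t..u, a v))

lemma eq_variationOfConstants_of_intervalIntegrable {a b W : ℝ → ℝ} {t s w : ℝ} (hts : t ≤ s)
    (ha : IntervalIntegrable a volume t s)
    (hint : IntervalIntegrable (fun u ↦ a u * W u + b u) volume t s)
    (hW : ∀ r ∈ Icc t s, W r = w + ∫ u in t..r, (a u * W u + b u)) :
    W s = variationOfConstants a b t w s := by
  have hE : AbsolutelyContinuousOnInterval (fun u ↦ Real.exp (-∫ v in t..u, a v)) t s :=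
    (ha.absolutelyContinuousOnInterval_intervalIntegral left_mem_uIcc).neg.real_exp
  have hconst : AbsolutelyContinuousOnInterval (fun _ : ℝ ↦ w) t s :=
    contDiff_const.contDiffOn.absolutelyContinuousOnInterval
  have hG : AbsolutelyContinuousOnInterval (fun r ↦ w + ∫ u in t..r, (a u * W u + b u)) t s :=
    hconst.add (hint.absolutelyContinuousOnInterval_intervalIntegral left_mem_uIcc)
  have key := hG.integral_deriv_mul_eq_sub hE
  have hcongr : ∫ u in t..s, b u * Real.exp (-∫ v in t..u, a v)
      = ∫ u in t..s, (deriv (fun r ↦ w + ∫ u in t..r, (a u * W u + b u)) u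
          * Real.exp (-∫ v in t..u, a v)
        + (w + ∫ v in t..u, (a v * W v + b v))
          * deriv (fun u ↦ Real.exp (-∫ v in t..u, a v)) u) := by
    apply intervalIntegral.integral_congr_ae
    filter_upwards [ha.ae_hasDerivAt_integral, hint.ae_hasDerivAt_integral] with u hau hfu hmem
    have hu : u ∈ uIcc t s := uIoc_subset_uIcc hmem
    rw [((hfu hu t left_mem_uIcc).const_add w).deriv, (hau hu t left_mem_uIcc).fun_neg.exp.deriv,
      ← hW u (by rwa [uIcc_of_le hts] at hu)]
    ring
  rw [← hcongr, ← hW s (right_mem_Icc.mpr hts)] at key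
  simp only [intervalIntegral.integral_same, neg_zero, Real.exp_zero, add_zero, mul_one] at key
  rw [variationOfConstants, key, add_sub_cancel, mul_left_comm, ← Real.exp_add]
  simp

lemma continuousOn_variationOfConstants {a b : ℝ → ℝ} {t s w : ℝ}
    (ha : IntervalIntegrable a volume t s) (hb : IntervalIntegrable b volume t s) :
    ContinuousOn (variationOfConstants a b t w) (uIcc t s) := by
  have hA := (ha.absolutelyContinuousOnInterval_intervalIntegral left_mem_uIcc).continuousOn
  have hbE := hb.mul_continuousOn hA.neg.rexp
  exact hA.rexp.mul (continuousOn_const.add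
    (hbE.absolutelyContinuousOnInterval_intervalIntegral left_mem_uIcc).continuousOn)

/-- A solution of `W = w + ∫ (a W + b)` automatically has an integrable right-hand side: beyond
a point where integrability failed, `W` would be constant. -/
lemma intervalIntegrable_of_linear_integral_equation {a b W : ℝ → ℝ} {t T w : ℝ} (htT : t ≤ T)
    (ha : IntervalIntegrable a volume t T) (hb : IntervalIntegrable b volume t T)
    (hW : ∀ s ∈ Icc t T, W s = w + ∫ u in t..s, (a u * W u + b u)) :
    IntervalIntegrable (fun u ↦ a u * W u + b u) volume t T := by
  classical
  set S : Set ℝ := {s | t ≤ s ∧ IntervalIntegrable (fun u ↦ a u * W u + b u) volume t s}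
  have hSmeas : MeasurableSet S := by
    refine OrdConnected.measurableSet ⟨fun p hp q hq r hr ↦ ⟨hp.1.trans hr.1, ?_⟩⟩
    have htr := hp.1.trans hr.1
    refine hq.2.mono_set ?_
    rw [uIcc_of_le htr, uIcc_of_le hq.1]
    exact Icc_subset_Icc_right hr.2
  have hvar := ha.mul_continuousOn (continuousOn_variationOfConstants (w := w) ha hb)
  have hcst := ha.mul_const w
  rw [intervalIntegrable_iff_integrableOn_Ioc_of_le htT] at hvar hcst hb ⊢
  have hpw := Integrable.piecewise hSmeas hvar.integrableOn hcst.integrableOn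
  refine (hpw.add hb).congr ?_
  filter_upwards [ae_restrict_mem measurableSet_Ioc] with s hs
  have hs' : s ∈ Icc t T := Ioc_subset_Icc_self hs
  by_cases hsS : s ∈ S
  · have := eq_variationOfConstants_of_intervalIntegrable hs'.1
      (ha.mono_set (by rw [uIcc_of_le htT, uIcc_of_le hs'.1]; exact Icc_subset_Icc_right hs'.2))
      hsS.2 fun r hr ↦ hW r ⟨hr.1, hr.2.trans hs'.2⟩
    simp [hsS, this]
  · have hWs : W s = w := by
      rw [hW s hs', intervalIntegral.integral_undef fun h ↦ hsS ⟨hs'.1, h⟩, add_zero]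
    simp [hsS, hWs]

lemma eq_variationOfConstants {a b W : ℝ → ℝ} {t T w : ℝ}
    (ha : IntervalIntegrable a volume t T) (hb : IntervalIntegrable b volume t T)
    (hW : ∀ s ∈ Icc t T, W s = w + ∫ u in t..s, (a u * W u + b u)) {s : ℝ} (hs : s ∈ Icc t T) :
    W s = variationOfConstants a b t w s := by
  have hsub : uIcc t s ⊆ uIcc t T := by
    rw [uIcc_of_le (hs.1.trans hs.2), uIcc_of_le hs.1]
    exact Icc_subset_Icc_right hs.2
  exact eq_variationOfConstants_of_intervalIntegrable hs.1 (ha.mono_set hsub)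
    ((intervalIntegrable_of_linear_integral_equation (hs.1.trans hs.2) ha hb hW).mono_set hsub)
    fun r hr ↦ hW r ⟨hr.1, hr.2.trans hs.2⟩

/-- **Deterministic maximum principle.** With constants `β, λ, ε > 0`,
`ε̃ = εβ/(2λ)`, `κ = β√(1 + 1/ε̃)`, initial time `t ∈ [0,T)` and initial states
`(x,y,z)`, let `(C¹,C²)` solve the linear system `M_t (C¹,C²)ᵀ = (−x̄, −y/λ)ᵀ` with
`x̄ = x + (1 − e^{−∫_t^T θ})z`, and define
`q*_s = C¹ e^{κ(T−s)} + C² e^{−κ(T−s)} − (C¹ + C²)`. If the state trajectories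
`X, Y, Z` solve the corresponding forward ODEs on `[t,T]`, then there exist absolutely
continuous adjoint functions `U^X, U^Y, U^Z` on `[t,T]` satisfying the backward adjoint
system together with the optimality condition `U^X_s + λ U^Y_s + ε q*_s = 0`. -/
theorem deterministic_maximum_principle
    (T beta lam eps : ℝ) (hT : 0 < T) (hbeta : 0 < beta) (hlam : 0 < lam) (heps : 0 < eps)
    (epsTil kappa : ℝ) (hepsTil : epsTil = eps * beta / (2 * lam))
    (hkappa : kappa = beta * Real.sqrt (1 + epsTil⁻¹))
    (theta : ℝ → ℝ) (htheta_meas : Measurable theta)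
    (htheta_bdd : ∃ M, ∀ s ∈ Icc (0:ℝ) T, |theta s| ≤ M)
    (t : ℝ) (ht : t ∈ Ico (0:ℝ) T) (x y z : ℝ)
    (a11 a12 a21 a22 : ℝ)
    (ha11 : a11 = kappa⁻¹ * Real.exp (kappa * (T - t)) - (T - t)
        + ((kappa + beta)⁻¹ - beta⁻¹ - kappa⁻¹))
    (ha12 : a12 = -kappa⁻¹ * Real.exp (-kappa * (T - t)) - (T - t)
        + (-(kappa - beta)⁻¹ - beta⁻¹ + kappa⁻¹))
    (ha21 : a21 = Real.exp (kappa * (T - t)) * (kappa - beta)⁻¹ + beta⁻¹)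
    (ha22 : a22 = -Real.exp (-kappa * (T - t)) * (kappa + beta)⁻¹ + beta⁻¹)
    (xbar : ℝ) (hxbar : xbar = x + (1 - Real.exp (-(∫ u in t..T, theta u))) * z)
    (C1 C2 : ℝ)
    (hlin1 : a11 * C1 + a12 * C2 = -xbar)
    (hlin2 : a21 * C1 + a22 * C2 = -(y / lam))
    (qstar : ℝ → ℝ)
    (hqstar : ∀ s, qstar s = C1 * Real.exp (kappa * (T - s))
        + C2 * Real.exp (-kappa * (T - s)) - (C1 + C2))
    (X Y Z : ℝ → ℝ)
    (hZ : ∀ s ∈ Icc t T, Z s = z + ∫ u in t..s, (-(theta u) * Z u))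
    (hX : ∀ s ∈ Icc t T, X s = x + ∫ u in t..s, (qstar u + theta u * Z u))
    (hY : ∀ s ∈ Icc t T, Y s = y + ∫ u in t..s, (-beta * Y u + lam * qstar u)) :
    ∃ UX UY UZ : ℝ → ℝ,
      (∀ s ∈ Icc t T, UX s = lam * X T - Y T) ∧
      UY T = -X T + Y T / lam ∧
      (∀ s ∈ Icc t T, UY s = UY T + ∫ u in s..T, (-beta * UY u + (2 * beta / lam) * Y u)) ∧
      UZ T = 0 ∧
      (∀ s ∈ Icc t T, UZ s = UZ T + ∫ u in s..T, (theta u * (UX u - UZ u))) ∧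
      (∀ s ∈ Icc t T, UX s + lam * UY s + eps * qstar s = 0) := by
  obtain ⟨ht0, htT⟩ := ht
  -- the decay rate `kappa`
  have hepsTil_pos : 0 < epsTil := by rw [hepsTil]; positivity
  have hinv_pos : 0 < epsTil⁻¹ := inv_pos.mpr hepsTil_pos
  have hkb : beta < kappa := by
    rw [hkappa]
    exact lt_mul_of_one_lt_right hbeta (Real.lt_sqrt_of_sq_lt (by linarith))
  have hk : 0 < kappa := hbeta.trans hkb
  have hkb' : 0 < kappa - beta := sub_pos.mpr hkb
  have hkap : eps * ((kappa - beta) * (kappa + beta)) = 2 * lam * beta := by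
    have hsq : kappa ^ 2 = beta ^ 2 * (1 + epsTil⁻¹) := by
      rw [hkappa, mul_pow, Real.sq_sqrt (by linarith)]
    have : (kappa - beta) * (kappa + beta) = beta ^ 2 * epsTil⁻¹ := by linear_combination hsq
    rw [this, hepsTil]
    field_simp
  have hpinv : (kappa + beta)⁻¹ = eps * (kappa - beta) / (2 * lam * beta) := by
    rw [← hkap]; field_simp
  have hminv : (kappa - beta)⁻¹ = eps * (kappa + beta) / (2 * lam * beta) := by
    rw [← hkap]; field_simp
  -- the exponentials and the control
  have hep : ∀ s, HasDerivAt (fun s ↦ Real.exp (kappa * (T - s)))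
      (-kappa * Real.exp (kappa * (T - s))) s := fun s ↦ by
    refine (((hasDerivAt_id' s).const_sub T).const_mul kappa).exp.congr_deriv ?_
    ring
  have hem : ∀ s, HasDerivAt (fun s ↦ Real.exp (-kappa * (T - s)))
      (kappa * Real.exp (-kappa * (T - s))) s := fun s ↦ by
    refine (((hasDerivAt_id' s).const_sub T).const_mul (-kappa)).exp.congr_deriv ?_
    ring
  obtain rfl : qstar = fun s ↦ C1 * Real.exp (kappa * (T - s))
      + C2 * Real.exp (-kappa * (T - s)) - (C1 + C2) := funext hqstar
  clear hqstar
  -- the impact state in closed form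
  set P : ℝ → ℝ := fun s ↦ lam * (-(C1 * Real.exp (kappa * (T - s)) * (kappa - beta)⁻¹)
      + C2 * Real.exp (-kappa * (T - s)) * (kappa + beta)⁻¹ - (C1 + C2) * beta⁻¹) with hP
  have hPt : P t = y := by
    have : y = -lam * (a21 * C1 + a22 * C2) := by rw [hlin2]; field_simp
    rw [this, ha21, ha22, hP]; ring
  have hPderiv : ∀ s, HasDerivAt P (-beta * P s + lam * (C1 * Real.exp (kappa * (T - s))
      + C2 * Real.exp (-kappa * (T - s)) - (C1 + C2))) s := fun s ↦ by
    refine ((((((hep s).const_mul C1).mul_const (kappa - beta)⁻¹).fun_neg.fun_add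
      (((hem s).const_mul C2).mul_const (kappa + beta)⁻¹)).sub_const
        ((C1 + C2) * beta⁻¹)).const_mul lam).congr_deriv ?_
    simp only [hP]
    field_simp
    ring
  have hYP : ∀ s ∈ Icc t T, Y s = P s := by
    intro s hs
    have hb : IntervalIntegrable (fun u ↦ lam * (C1 * Real.exp (kappa * (T - u))
        + C2 * Real.exp (-kappa * (T - u)) - (C1 + C2))) volume t T :=
      Continuous.intervalIntegrable (by fun_prop) _ _
    rw [eq_variationOfConstants intervalIntegrable_const hb hY hs,
      eq_variationOfConstants (W := P) (w := y) intervalIntegrable_const hb (fun r _ ↦ ?_) hs]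
    rw [intervalIntegral.integral_eq_sub_of_hasDerivAt (fun u _ ↦ hPderiv u)
      (Continuous.intervalIntegrable (by fun_prop) _ _), hPt]
    ring
  -- the terminal value of `X`
  obtain ⟨M, hM⟩ := htheta_bdd
  have hth : IntervalIntegrable theta volume t T := by
    rw [intervalIntegrable_iff_integrableOn_Ioc_of_le htT.le]
    refine Measure.integrableOn_of_bounded (M := M) (by simp) htheta_meas.aestronglyMeasurable ?_
    filter_upwards [ae_restrict_mem measurableSet_Ioc] with s hs
    exact hM s ⟨ht0.trans hs.1.le, hs.2⟩
  have hZ' : ∀ s ∈ Icc t T, Z s = z + ∫ u in t..s, (-theta u * Z u + 0) := by simpa using hZ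
  have hthneg : IntervalIntegrable (fun u ↦ -theta u) volume t T := hth.neg
  have hzero : IntervalIntegrable (fun _ ↦ (0 : ℝ)) volume t T := intervalIntegrable_const
  have hTmem : T ∈ Icc t T := right_mem_Icc.mpr htT.le
  have hZT : Z T = Real.exp (-∫ u in t..T, theta u) * z := by
    simpa [variationOfConstants] using eq_variationOfConstants hthneg hzero hZ' hTmem
  have hthZ : IntervalIntegrable (fun u ↦ theta u * Z u) volume t T := by
    simpa [Pi.neg_def] using
      (intervalIntegrable_of_linear_integral_equation htT.le hthneg hzero hZ').neg
  have hintZ : ∫ u in t..T, theta u * Z u = z - Z T := by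
    rw [hZ T hTmem]
    simp
  have hintq : ∫ u in t..T, (C1 * Real.exp (kappa * (T - u))
      + C2 * Real.exp (-kappa * (T - u)) - (C1 + C2))
      = C1 * (kappa⁻¹ * Real.exp (kappa * (T - t)) - kappa⁻¹)
        + C2 * (kappa⁻¹ - kappa⁻¹ * Real.exp (-kappa * (T - t))) - (C1 + C2) * (T - t) := by
    rw [intervalIntegral.integral_eq_sub_of_hasDerivAt
      (f := fun s ↦ -(C1 * kappa⁻¹) * Real.exp (kappa * (T - s))
        + C2 * kappa⁻¹ * Real.exp (-kappa * (T - s)) - (C1 + C2) * s) (fun u _ ↦ ?_)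
      (Continuous.intervalIntegrable (by fun_prop) _ _)]
    · simp; ring
    · refine ((((hep u).const_mul (-(C1 * kappa⁻¹))).fun_add
        ((hem u).const_mul (C2 * kappa⁻¹))).fun_sub
        ((hasDerivAt_id' u).const_mul (C1 + C2))).congr_deriv ?_
      field_simp
  have hXT : X T = C1 * (beta⁻¹ - (kappa + beta)⁻¹) + C2 * (beta⁻¹ + (kappa - beta)⁻¹) := by
    rw [hX T hTmem, intervalIntegral.integral_add
      (Continuous.intervalIntegrable (by fun_prop) _ _) hthZ, hintZ, hintq, hZT]
    rw [ha11, ha12, hxbar] at hlin1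
    linear_combination hlin1
  have hYT : Y T = lam * (-(C1 * (kappa - beta)⁻¹) + C2 * (kappa + beta)⁻¹
      - (C1 + C2) * beta⁻¹) := by
    rw [hYP T hTmem, hP]; simp
  have hc : lam * X T - Y T = (C1 + C2) * (2 * lam / beta + eps) := by
    rw [hXT, hYT, hpinv, hminv]
    field_simp
    ring
  -- the adjoint functions
  set c : ℝ := lam * X T - Y T with hcdef
  refine ⟨fun _ ↦ c, fun s ↦ -(c + eps * (C1 * Real.exp (kappa * (T - s))
      + C2 * Real.exp (-kappa * (T - s)) - (C1 + C2))) / lam,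
    fun s ↦ c * (1 - Real.exp (∫ u in T..s, theta u)), fun _ _ ↦ rfl, ?_, ?_, ?_, ?_, ?_⟩
  · simp only [hcdef, sub_self, mul_zero, Real.exp_zero]
    field_simp
    ring
  · intro s hs
    beta_reduce
    have hcongr : ∀ u ∈ uIcc s T,
        -beta * (-(c + eps * (C1 * Real.exp (kappa * (T - u))
          + C2 * Real.exp (-kappa * (T - u)) - (C1 + C2))) / lam) + 2 * beta / lam * Y u
        = (eps / lam) * (C1 * (-kappa * Real.exp (kappa * (T - u)))
          + C2 * (kappa * Real.exp (-kappa * (T - u)))) := by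
      intro u hu
      rw [uIcc_of_le hs.2] at hu
      rw [hYP u ⟨hs.1.trans hu.1, hu.2⟩, hc]
      simp only [hP, hpinv, hminv]
      field_simp
      ring
    rw [intervalIntegral.integral_congr hcongr,
      intervalIntegral.integral_eq_sub_of_hasDerivAt (fun u _ ↦
        (((hep u).const_mul C1).fun_add ((hem u).const_mul C2)).const_mul (eps / lam))
        (Continuous.intervalIntegrable (by fun_prop) _ _)]
    field_simp
    ring
  · simp
  · intro s hs
    have hths : IntervalIntegrable theta volume s T := hth.mono_set (by
      rw [uIcc_of_le hs.2, uIcc_of_le htT.le]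
      exact Icc_subset_Icc_left hs.1)
    have hint : ∀ u, theta u * (c - c * (1 - Real.exp (∫ v in T..u, theta v)))
        = c * (theta u * Real.exp (∫ v in T..u, theta v)) := fun u ↦ by ring
    simp_rw [hint]
    rw [intervalIntegral.integral_const_mul,
      intervalIntegral_mul_exp_integral hths right_mem_uIcc]
    simp
  · intro s _
    field_simp
    ring
end
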